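/- For every positive integer m and nonnegative integer x, △_{2m}(x/(4m)) (interpreted as 0 if 4m does not divide x) equals the sum, over all tuples (k_1,...,k_m,l_1,...,l_m) of odd positive integers with k_1 l_1 + ... + k_m l_m = m^2 + x and k_i ≡ ±(2i-1) (mod 4m) for each i, of (-1)^{|{i : k_i ≡ 1-2i (mod 4m)}|}. -/

import Mathlib

/-- The number of ordered representations of `n` as a sum of `k` triangular numbers. -/
noncomputable def triangleReps (k n : ℕ) : ℕ :=
  Nat.card {f : Fin k → ℕ // (∑ i, f i * (f i + 1) / 2) = n}

open Finset

/-- The ratio `(Q; Q²)ₙ / (Q²; Q²)ₙ` of `q`-Pochhammer symbols. -/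
def pochRatio {K : Type*} [Field K] (Q : K) (n : ℕ) : K :=
  ∏ i ∈ range n, (1 - Q ^ (2 * i + 1)) / (1 - Q ^ (2 * i + 2))

section Field

variable {K : Type*} [Field K] {Q : K}

theorem pochRatio_succ (Q : K) (n : ℕ) :
    pochRatio Q (n + 1) = pochRatio Q n * ((1 - Q ^ (2 * n + 1)) / (1 - Q ^ (2 * n + 2))) :=
  prod_range_succ _ _

/-- A partial fraction expansion with simple poles at `z = Q ^ (-2 * k)`, `k ≤ M`. -/
theorem sum_pochRatio_div (hQ : ∀ j, 1 - Q ^ (j + 1) ≠ 0) (M : ℕ) :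
    ∀ z : K, (∀ k ≤ M, 1 - z * Q ^ (2 * k) ≠ 0) →
      ∑ k ∈ range (M + 1),
          Q ^ k * pochRatio Q (M - k) * pochRatio Q k / (1 - z * Q ^ (2 * k)) =
        (∏ j ∈ range M, (1 - z * Q ^ (2 * j + 1))) /
          ∏ j ∈ range (M + 1), (1 - z * Q ^ (2 * j)) := by
  induction M with
  | zero => intro z hz; simp [pochRatio]
  | succ M ih =>
    intro z hz
    have hspec : ∑ k ∈ range (M + 1),
          Q ^ k * pochRatio Q (M - k) * pochRatio Q k / (1 - Q ^ (2 * k + 2)) * (1 - Q) =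
        pochRatio Q (M + 1) := by
      have h2 : ∀ k, Q ^ 2 * Q ^ k = Q ^ (k + 2) := fun k => by ring
      have h := ih (Q ^ 2) (fun k _ => by rw [h2]; exact hQ _)
      simp only [h2] at h
      rw [← sum_mul, h, pochRatio, prod_div_distrib,
        prod_range_succ' (fun j => 1 - Q ^ (2 * j + 1)) M]
      have hn : ∏ j ∈ range (M + 1), (1 - Q ^ (2 * j + 2)) ≠ 0 :=
        prod_ne_zero_iff.mpr fun _ _ => hQ _
      have : ∀ j, 2 * (j + 1) + 1 = 2 * j + 1 + 2 := fun j => by ring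
      simp only [this, mul_zero, zero_add, pow_one]
      ring
    have hstep : (1 - z * Q ^ (2 * M + 2)) * ∑ k ∈ range (M + 1),
          Q ^ k * pochRatio Q (M + 1 - k) * pochRatio Q k / (1 - z * Q ^ (2 * k)) =
        (1 - z * Q ^ (2 * M + 1)) * ∑ k ∈ range (M + 1),
          Q ^ k * pochRatio Q (M - k) * pochRatio Q k / (1 - z * Q ^ (2 * k)) -
        Q ^ (M + 1) * pochRatio Q (M + 1) := by
      rw [← sum_range_reflect] at hspec
      rw [← hspec, mul_sum, mul_sum, mul_sum, ← sum_sub_distrib]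
      refine sum_congr rfl fun k hk => ?_
      obtain ⟨d, rfl⟩ := Nat.exists_eq_add_of_le (Nat.lt_succ_iff.mp (mem_range.mp hk))
      rw [show k + d + 1 - k = d + 1 by omega, show k + d - k = d by omega,
        show k + d + 1 - 1 - k = d by omega, show k + d - d = k by omega, pochRatio_succ]
      have h1 := hz k (by omega)
      have h2 : 1 - Q ^ (2 * d + 2) ≠ 0 := hQ _
      field_simp
      ring
    have hM := hz (M + 1) le_rfl
    rw [sum_range_succ, Nat.sub_self, prod_range_succ _ M, prod_range_succ _ (M + 1),
      eq_div_iff (mul_ne_zero (prod_ne_zero_iff.mpr fun k hk =>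
        hz k (by have := mem_range.mp hk; omega)) hM)]
    have hP : ∏ j ∈ range (M + 1), (1 - z * Q ^ (2 * j)) ≠ 0 :=
      prod_ne_zero_iff.mpr fun k hk => hz k (by have := mem_range.mp hk; omega)
    have hih := ih z fun k hk => hz k (by omega)
    rw [eq_div_iff hP] at hih
    have h0 : pochRatio Q 0 = 1 := by simp [pochRatio]
    rw [h0, mul_one]
    have hl : Q ^ (M + 1) * pochRatio Q (M + 1) / (1 - z * Q ^ (2 * (M + 1))) *
        (1 - z * Q ^ (2 * (M + 1))) = Q ^ (M + 1) * pochRatio Q (M + 1) :=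
      div_mul_cancel₀ _ hM
    have e : 2 * (M + 1) = 2 * M + 2 := by ring
    rw [e] at hl ⊢
    linear_combination (∏ j ∈ range (M + 1), (1 - z * Q ^ (2 * j))) * (hstep + hl) +
      (1 - z * Q ^ (2 * M + 1)) * hih

/-- A finite form of Gauss's identity `∑ Q ^ (n(n+1)/2) = (Q²; Q²) / (Q; Q²)`. -/
theorem pochRatio_mul_sum_triangle (hQ : ∀ j, 1 - Q ^ (j + 1) ≠ 0) (n : ℕ) :
    pochRatio Q n * ∑ s ∈ range (2 * n), Q ^ (s * (s + 1) / 2) =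
      ∑ s ∈ range n, pochRatio Q s * Q ^ (s * (2 * n + 1)) := by
  induction n with
  | zero => simp
  | succ n ih =>
    have htel : ∀ N, ∑ s ∈ range N, (pochRatio Q s * Q ^ (s * (2 * (n + 1) + 1)) *
          (1 - Q ^ (2 * n + 2)) -
          pochRatio Q s * Q ^ (s * (2 * n + 1)) * (1 - Q ^ (2 * n + 1))) =
        pochRatio Q N * (1 - Q ^ (2 * N)) * Q ^ (N * (2 * n + 1)) := by
      intro N
      induction N with
      | zero => simp
      | succ N ihN =>
        rw [sum_range_succ, ihN, pochRatio_succ, show 2 * (N + 1) = 2 * N + 2 by ring]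
        have h2 : 1 - Q ^ (2 * N + 2) ≠ 0 := hQ _
        field_simp
        ring
    have hn := htel n
    rw [sum_sub_distrib, ← sum_mul, ← sum_mul, ← ih] at hn
    have h2 : 1 - Q ^ (2 * n + 2) ≠ 0 := hQ _
    have e1 : 2 * n * (2 * n + 1) / 2 = n * (2 * n + 1) := by
      rw [mul_assoc, Nat.mul_div_cancel_left _ two_pos]
    have e2 : (2 * n + 1) * (2 * n + 1 + 1) / 2 = (n + 1) * (2 * n + 1) := by
      rw [show (2 * n + 1) * (2 * n + 1 + 1) = 2 * ((n + 1) * (2 * n + 1)) by ring,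
        Nat.mul_div_cancel_left _ two_pos]
    rw [show 2 * (n + 1) = 2 * n + 1 + 1 by ring, sum_range_succ, sum_range_succ, e1, e2,
      sum_range_succ, pochRatio_succ]
    rw [show 2 * (n + 1) = 2 * n + 1 + 1 by ring] at hn
    refine mul_right_cancel₀ h2 ?_
    have h3 : pochRatio Q n * ((1 - Q ^ (2 * n + 1)) / (1 - Q ^ (2 * n + 2))) *
        (1 - Q ^ (2 * n + 2)) = pochRatio Q n * (1 - Q ^ (2 * n + 1)) := by
      field_simp
    linear_combination (∑ s ∈ range (2 * n), Q ^ (s * (s + 1) / 2) + Q ^ (n * (2 * n + 1)) +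
      Q ^ ((n + 1) * (2 * n + 1))) * h3 - hn

/-- The symmetric form of `sum_pochRatio_div` with `z = q ^ (2 * a - 8 * m * N)`. -/
theorem sum_pochRatio_zpow {q : K} (hq0 : q ≠ 0) (hq : ∀ n : ℤ, n ≠ 0 → 1 - q ^ n ≠ 0)
    {m : ℕ} (hm : 0 < m) (N : ℕ) {a : ℤ} (ha : Odd a) :
    (∑ k ∈ range (2 * N + 1), pochRatio (q ^ (4 * m)) (2 * N - k) * pochRatio (q ^ (4 * m)) k *
        (q ^ (a + 4 * m * (k - N)) / (1 - q ^ (2 * (a + 4 * m * (k - N)))))) *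
        ((∏ j ∈ range (2 * N), (1 - q ^ (2 * a + 8 * m * j - 8 * m * N))) *
          (1 - q ^ (2 * a + 8 * m * N))) =
      q ^ (a - 4 * m * N) *
        ∏ j ∈ range (2 * N), (1 - q ^ (2 * a + 8 * m * j - 8 * m * N + 4 * m)) := by
  have hQ : ∀ j, 1 - (q ^ (4 * m)) ^ (j + 1) ≠ 0 := fun j => by
    rw [← pow_mul]
    exact_mod_cast hq ((4 * m * (j + 1) : ℕ) : ℤ) (by positivity)
  have hz : ∀ j : ℕ, q ^ (2 * a - 8 * m * N) * (q ^ (4 * m)) ^ j =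
      q ^ (2 * a + 4 * m * j - 8 * m * N) := fun j => by
    rw [← pow_mul, ← zpow_natCast, ← zpow_add₀ hq0]
    push_cast
    ring_nf
  have hz2 : ∀ j : ℕ, q ^ (2 * a - 8 * m * N) * (q ^ (4 * m)) ^ (2 * j) =
      q ^ (2 * a + 8 * m * j - 8 * m * N) := fun j => by
    rw [hz]; push_cast; ring_nf
  have hz1 : ∀ j : ℕ, q ^ (2 * a - 8 * m * N) * (q ^ (4 * m)) ^ (2 * j + 1) =
      q ^ (2 * a + 8 * m * j - 8 * m * N + 4 * m) := fun j => by
    rw [hz]; push_cast; ring_nf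
  have hne : ∀ j : ℕ, 1 - q ^ (2 * a + 8 * m * j - 8 * m * N) ≠ 0 := fun j => by
    obtain ⟨b, rfl⟩ := ha
    refine hq _ fun h => ?_
    have : (1 + 2 * (b + 2 * m * j - 2 * m * N) : ℤ) = 0 := by linarith
    omega
  have h := sum_pochRatio_div hQ (2 * N) (q ^ (2 * a - 8 * m * N))
    (fun k _ => by rw [hz2]; exact hne k)
  simp only [hz1, hz2] at h
  rw [eq_div_iff (prod_ne_zero_iff.mpr fun _ _ => hne _), prod_range_succ] at h
  have e : (2 * a + 8 * m * (2 * N : ℕ) - 8 * m * N : ℤ) = 2 * a + 8 * m * N := by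
    push_cast; ring
  rw [e] at h
  rw [← h, ← mul_assoc (q ^ _), mul_sum]
  congr 1
  refine sum_congr rfl fun k _ => ?_
  rw [show 2 * (a + 4 * m * ((k : ℤ) - N)) = 2 * a + 8 * m * k - 8 * m * N by ring,
    show a + 4 * m * ((k : ℤ) - N) = (a - 4 * m * N) + ((4 * m * k : ℕ) : ℤ) by push_cast; ring,
    zpow_add₀ hq0, zpow_natCast, pow_mul]
  ring

theorem prod_one_sub_zpow_reflect {q : K} (hq0 : q ≠ 0) (m N : ℕ) (a : ℤ) :
    ∏ j ∈ range (2 * N), (1 - q ^ (2 * (2 * m - a) + 8 * m * j - 8 * m * N + 4 * m)) =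
      q ^ (8 * m * N - 4 * a * N) *
        ∏ j ∈ range (2 * N), (1 - q ^ (2 * a + 8 * m * j - 8 * m * N)) := by
  have hprod : ∀ n : ℕ, ∏ j ∈ range n, q ^ (-(2 * a + 8 * m * j - 8 * m * N)) =
      q ^ (8 * m * N * n - 2 * a * n - 4 * m * n * (n - 1)) := by
    intro n
    induction n with
    | zero => simp
    | succ n ih =>
      rw [prod_range_succ, ih, ← zpow_add₀ hq0]
      congr 1
      push_cast
      ring
  have hneg : ∏ j ∈ range (2 * N), (-1 : K) = 1 := by simp
  have h2 := hprod (2 * N)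
  rw [show (8 * m * N * (2 * N : ℕ) - 2 * a * (2 * N : ℕ) - 4 * m * (2 * N : ℕ) *
    ((2 * N : ℕ) - 1) : ℤ) = 8 * m * N - 4 * a * N by push_cast; ring] at h2
  have h3 : q ^ (8 * m * N - 4 * a * N : ℤ) =
      ∏ j ∈ range (2 * N), (-1) * q ^ (-(2 * a + 8 * m * j - 8 * m * N)) := by
    rw [prod_mul_distrib, hneg, one_mul, h2]
  rw [h3, ← prod_mul_distrib, ← prod_range_reflect]
  refine prod_congr rfl fun j hj => ?_
  have hj' := mem_range.mp hj
  have e : ((2 * N - 1 - j : ℕ) : ℤ) = 2 * N - 1 - j := by omega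
  rw [e, show 2 * (2 * m - a) + 8 * m * (2 * N - 1 - j) - 8 * m * N + 4 * m =
    -(2 * a + 8 * m * j - 8 * m * N) by ring]
  have := zpow_ne_zero (2 * a + 8 * m * j - 8 * m * N) hq0
  rw [zpow_neg]
  field_simp
  ring

theorem prod_sum_pochRatio_zpow {q : K} (hq0 : q ≠ 0) (hq : ∀ n : ℤ, n ≠ 0 → 1 - q ^ n ≠ 0)
    {m : ℕ} (hm : 0 < m) (N : ℕ) :
    (∏ i ∈ range m, ∑ k ∈ range (2 * N + 1),
        pochRatio (q ^ (4 * m)) (2 * N - k) * pochRatio (q ^ (4 * m)) k *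
        (q ^ ((2 * i + 1 : ℤ) + 4 * m * (k - N)) /
          (1 - q ^ (2 * ((2 * i + 1 : ℤ) + 4 * m * (k - N)))))) *
        ∏ i ∈ range m, (1 - q ^ (2 * (2 * i + 1 : ℤ) + 8 * m * N)) = q ^ (m ^ 2) := by
  set C : ℤ → K := fun a => ∏ j ∈ range (2 * N), (1 - q ^ (2 * a + 8 * m * j - 8 * m * N)) with hC
  set A : ℤ → K :=
    fun a => ∏ j ∈ range (2 * N), (1 - q ^ (2 * a + 8 * m * j - 8 * m * N + 4 * m)) with hA
  have hC0 : ∏ i ∈ range m, C (2 * i + 1) ≠ 0 := by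
    refine prod_ne_zero_iff.mpr fun i _ => prod_ne_zero_iff.mpr fun j _ => hq _ fun h => ?_
    have : (1 + 2 * (i + 2 * m * j - 2 * m * N) : ℤ) = 0 := by linarith
    omega
  have hAC : (∏ i ∈ range m, q ^ ((2 * i + 1 : ℤ) - 4 * m * N)) *
      ∏ i ∈ range m, A (2 * i + 1) = q ^ (m ^ 2) * ∏ i ∈ range m, C (2 * i + 1) := by
    have hrefl : ∏ i ∈ range m, A (2 * i + 1) = ∏ i ∈ range m, A (2 * m - (2 * i + 1)) := by
      rw [← prod_range_reflect]
      refine prod_congr rfl fun i hi => ?_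
      have := mem_range.mp hi
      congr 1
      omega
    have hexp : ∀ n : ℕ, ∏ i ∈ range n, (q ^ ((2 * i + 1 : ℤ) - 4 * m * N) *
        q ^ (8 * m * N - 4 * (2 * i + 1) * N : ℤ)) =
        q ^ ((n : ℤ) ^ 2 + 4 * m * N * n - 4 * N * n ^ 2) := by
      intro n
      induction n with
      | zero => simp
      | succ n ih =>
        rw [prod_range_succ, ih, ← zpow_add₀ hq0, ← zpow_add₀ hq0]
        congr 1
        push_cast
        ring
    have hm2 := hexp m
    rw [show (m ^ 2 + 4 * m * N * m - 4 * N * m ^ 2 : ℤ) = ((m ^ 2 : ℕ) : ℤ) by push_cast; ring,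
      zpow_natCast] at hm2
    rw [hrefl, ← hm2, ← prod_mul_distrib, ← prod_mul_distrib]
    refine prod_congr rfl fun i _ => ?_
    simp only [hA, hC]
    rw [prod_one_sub_zpow_reflect hq0, mul_assoc (q ^ _)]
  refine mul_right_cancel₀ hC0 ?_
  rw [← hAC, mul_assoc, mul_comm (∏ i ∈ range m, (1 - _)), ← prod_mul_distrib, ← prod_mul_distrib,
    ← prod_mul_distrib]
  exact prod_congr rfl fun i _ => sum_pochRatio_zpow hq0 hq hm N ⟨i, rfl⟩

end Field

section PowerSeries

open PowerSeries

/-- `∑ₙ X ^ (4m · n(n+1)/2)` truncated to `n < L`. -/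
noncomputable def triangleSeries (m L : ℕ) : ℚ⟦X⟧ :=
  ∑ s ∈ range L, X ^ (4 * m * (s * (s + 1) / 2))

/-- The power series expansion of `pochRatio (X ^ (4 * m)) n`. -/
noncomputable def pochSeries (m n : ℕ) : ℚ⟦X⟧ :=
  ∏ i ∈ range n, (1 - X ^ (4 * m * (2 * i + 1))) * (1 - X ^ (4 * m * (2 * i + 2)))⁻¹

/-- The power series expansion of `X ^ k / (1 - X ^ (2 * k))`, that is `∑ X ^ (k * l)` over odd
positive `l`. -/
noncomputable def oddMultSeries (k : ℕ) : ℚ⟦X⟧ := X ^ k * (1 - X ^ (2 * k))⁻¹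

/-- The power series expansion of `X ^ n / (1 - X ^ (2 * n))` for an integer `n ≠ 0`. -/
noncomputable def signedOddMultSeries (n : ℤ) : ℚ⟦X⟧ := (n.sign : ℚ⟦X⟧) * oddMultSeries n.natAbs

theorem one_sub_X_pow_mul_inv {k : ℕ} (hk : k ≠ 0) :
    (1 - X ^ k : ℚ⟦X⟧) * (1 - X ^ k)⁻¹ = 1 :=
  PowerSeries.mul_inv_cancel _ (by simp [hk])

/-- The variable as an element of the fraction field of `ℚ⟦X⟧`. -/
noncomputable def fracX : FractionRing ℚ⟦X⟧ := algebraMap ℚ⟦X⟧ _ X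

theorem fracX_ne_zero : fracX ≠ 0 := by
  simp [fracX]

theorem algebraMap_X_pow (k : ℕ) :
    algebraMap ℚ⟦X⟧ (FractionRing ℚ⟦X⟧) (X ^ k) = fracX ^ k := map_pow _ _ _

theorem one_sub_fracX_pow_ne_zero {k : ℕ} (hk : k ≠ 0) : 1 - fracX ^ k ≠ 0 := by
  intro h
  have h1 := congrArg (algebraMap ℚ⟦X⟧ (FractionRing ℚ⟦X⟧)) (one_sub_X_pow_mul_inv hk)
  rw [map_mul, map_sub, map_one, algebraMap_X_pow, h, zero_mul] at h1
  exact zero_ne_one h1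

theorem one_sub_fracX_zpow_ne_zero (n : ℤ) (hn : n ≠ 0) : 1 - fracX ^ n ≠ 0 := by
  have h := one_sub_fracX_pow_ne_zero (Int.natAbs_ne_zero.mpr hn)
  rcases Int.natAbs_eq n with h' | h' <;> rw [h']
  · rwa [zpow_natCast]
  · rw [zpow_neg, zpow_natCast]
    intro h0
    refine h ?_
    rw [sub_eq_zero, eq_comm, inv_eq_one] at h0
    rw [h0, sub_self]

theorem algebraMap_one_sub_X_pow_inv {k : ℕ} (hk : k ≠ 0) :
    algebraMap ℚ⟦X⟧ (FractionRing ℚ⟦X⟧) (1 - X ^ k)⁻¹ = (1 - fracX ^ k)⁻¹ := by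
  refine eq_inv_of_mul_eq_one_right ?_
  rw [← algebraMap_X_pow, ← map_one (algebraMap ℚ⟦X⟧ (FractionRing ℚ⟦X⟧)), ← map_sub, ← map_mul,
    one_sub_X_pow_mul_inv hk]

theorem algebraMap_pochSeries {m : ℕ} (hm : 0 < m) (n : ℕ) :
    algebraMap ℚ⟦X⟧ (FractionRing ℚ⟦X⟧) (pochSeries m n) = pochRatio (fracX ^ (4 * m)) n := by
  rw [pochSeries, pochRatio, map_prod]
  refine prod_congr rfl fun i _ => ?_
  rw [map_mul, algebraMap_one_sub_X_pow_inv (by positivity), map_sub, map_one, algebraMap_X_pow,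
    ← pow_mul, ← pow_mul, div_eq_mul_inv]

theorem algebraMap_signedOddMultSeries {n : ℤ} (hn : n ≠ 0) :
    algebraMap ℚ⟦X⟧ (FractionRing ℚ⟦X⟧) (signedOddMultSeries n) =
      fracX ^ n / (1 - fracX ^ (2 * n)) := by
  have h0 := Int.natAbs_ne_zero.mpr hn
  rw [signedOddMultSeries, oddMultSeries, map_mul, map_mul, map_intCast,
    algebraMap_one_sub_X_pow_inv (by positivity), algebraMap_X_pow]
  have h1 := one_sub_fracX_zpow_ne_zero (2 * n) (by positivity)
  have hx := zpow_ne_zero n fracX_ne_zero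
  rw [← zpow_natCast, ← zpow_natCast]
  push_cast
  rcases lt_or_gt_of_ne hn with h | h
  · have e2 : fracX ^ (2 * n) = (fracX ^ n) ^ 2 := by rw [mul_comm, zpow_mul]; rfl
    rw [Int.sign_eq_neg_one_of_neg h, abs_of_neg h, mul_neg, zpow_neg, zpow_neg, e2,
      Int.cast_neg, Int.cast_one]
    rw [e2] at h1
    generalize fracX ^ n = y at *
    have h2 : 1 - (y ^ 2)⁻¹ ≠ 0 := fun h => h1 (by field_simp at h; linear_combination -h)
    field_simp
    have h3 : y ^ 2 - 1 ≠ 0 := fun h => h1 (by linear_combination -h)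
    field_simp
    ring
  · rw [Int.sign_eq_one_of_pos h, abs_of_pos h]
    simp [div_eq_mul_inv]

theorem prod_sum_pochSeries {m : ℕ} (hm : 0 < m) (N : ℕ) :
    (∏ i ∈ range m, ∑ k ∈ range (2 * N + 1), pochSeries m (2 * N - k) * pochSeries m k *
        signedOddMultSeries ((2 * i + 1 : ℤ) + 4 * m * (k - N))) *
      ∏ i ∈ range m, (1 - X ^ (2 * (2 * i + 1) + 8 * m * N)) = X ^ (m ^ 2) := by
  refine IsFractionRing.injective ℚ⟦X⟧ (FractionRing ℚ⟦X⟧) ?_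
  rw [algebraMap_X_pow, ← prod_sum_pochRatio_zpow fracX_ne_zero one_sub_fracX_zpow_ne_zero hm N,
    map_mul, map_prod, map_prod]
  congr 1
  · refine prod_congr rfl fun i _ => ?_
    rw [map_sum]
    refine sum_congr rfl fun k _ => ?_
    rw [map_mul, map_mul, algebraMap_pochSeries hm, algebraMap_pochSeries hm,
      algebraMap_signedOddMultSeries]
    intro h
    have : (1 + 2 * (i + 2 * m * (k - N)) : ℤ) = 0 := by linarith
    omega
  · refine prod_congr rfl fun i _ => ?_
    rw [map_sub, map_one, algebraMap_X_pow, ← zpow_natCast]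
    push_cast
    rfl

theorem pochSeries_mul_triangleSeries {m : ℕ} (hm : 0 < m) (n : ℕ) :
    pochSeries m n * triangleSeries m (2 * n) =
      ∑ s ∈ range n, pochSeries m s * X ^ (4 * m * (s * (2 * n + 1))) := by
  refine IsFractionRing.injective ℚ⟦X⟧ (FractionRing ℚ⟦X⟧) ?_
  have hQ : ∀ j, 1 - (fracX ^ (4 * m)) ^ (j + 1) ≠ 0 := fun j => by
    rw [← pow_mul]
    exact one_sub_fracX_pow_ne_zero (by positivity)
  have h := pochRatio_mul_sum_triangle hQ n
  simp only [triangleSeries, map_mul, map_sum, algebraMap_pochSeries hm, algebraMap_X_pow]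
  simpa only [← pow_mul] using h

theorem X_pow_dvd_pochSeries_mul_triangleSeries_sub_one {m : ℕ} (hm : 0 < m) {k L : ℕ}
    (hk : 2 * k ≤ L) : X ^ k ∣ pochSeries m k * triangleSeries m L - 1 := by
  obtain _ | k := k
  · simp
  have hsplit : triangleSeries m L = triangleSeries m (2 * (k + 1)) +
      ∑ s ∈ Ico (2 * (k + 1)) L, X ^ (4 * m * (s * (s + 1) / 2)) :=
    (sum_range_add_sum_Ico _ hk).symm
  have h0 : pochSeries m 0 * X ^ (4 * m * (0 * (2 * (k + 1) + 1))) = (1 : ℚ⟦X⟧) := by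
    simp [pochSeries]
  rw [hsplit, mul_add, pochSeries_mul_triangleSeries hm, sum_range_succ', h0]
  rw [show ∀ a b : ℚ⟦X⟧, a + 1 + b - 1 = a + b by intros; ring]
  refine dvd_add (dvd_sum fun s _ => ?_) (Dvd.dvd.mul_left (dvd_sum fun s hs => ?_) _)
  · refine Dvd.dvd.mul_left (pow_dvd_pow _ ?_) _
    nlinarith [Nat.zero_le (m * s * k), Nat.zero_le (m * k), Nat.zero_le (m * s)]
  · have hs' := (mem_Ico.mp hs).1
    refine pow_dvd_pow _ ?_
    have : s ≤ s * (s + 1) / 2 := by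
      rw [Nat.le_div_iff_mul_le two_pos]
      nlinarith
    nlinarith

theorem X_pow_dvd_signedOddMultSeries (n : ℤ) : X ^ n.natAbs ∣ signedOddMultSeries n :=
  Dvd.dvd.mul_left (dvd_mul_right _ _) _

theorem oddMultSeries_sub_sum {k : ℕ} (hk : 0 < k) (N : ℕ) :
    X ^ N ∣ oddMultSeries k - ∑ j ∈ range N, X ^ (k * (2 * j + 1)) := by
  have h := one_sub_X_pow_mul_inv (k := 2 * k) (by positivity)
  have hg : (1 - X ^ (2 * k)) * ∑ j ∈ range N, X ^ (k * (2 * j + 1)) =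
      (X ^ k - X ^ (k + 2 * k * N) : ℚ⟦X⟧) := by
    induction N with
    | zero => simp
    | succ N ih =>
      rw [sum_range_succ, mul_add, ih]
      ring
  have : oddMultSeries k - ∑ j ∈ range N, X ^ (k * (2 * j + 1)) =
      X ^ (k + 2 * k * N) * (1 - X ^ (2 * k))⁻¹ := by
    rw [oddMultSeries]
    linear_combination (∑ j ∈ range N, X ^ (k * (2 * j + 1))) * h - (1 - X ^ (2 * k))⁻¹ * hg
  rw [this]
  exact Dvd.dvd.mul_right (pow_dvd_pow _ (by nlinarith)) _

theorem X_pow_dvd_signedOddMultSeries_mul {m N k a : ℕ} (hm : 0 < m) (ha : a < 2 * m)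
    (hk : k ≤ 2 * N) :
    X ^ N ∣ signedOddMultSeries ((a : ℤ) + 4 * m * (k - N)) *
      (pochSeries m (2 * N - k) * pochSeries m k * triangleSeries m (4 * N) ^ 2 - 1) := by
  set P := triangleSeries m (4 * N)
  have h1 : X ^ k ∣ pochSeries m k * P - 1 :=
    X_pow_dvd_pochSeries_mul_triangleSeries_sub_one hm (by omega)
  have h2 : X ^ (2 * N - k) ∣ pochSeries m (2 * N - k) * P - 1 :=
    X_pow_dvd_pochSeries_mul_triangleSeries_sub_one hm (by omega)
  have h3 : X ^ (min k (2 * N - k)) ∣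
      pochSeries m (2 * N - k) * pochSeries m k * P ^ 2 - 1 := by
    rw [show pochSeries m (2 * N - k) * pochSeries m k * P ^ 2 - 1 =
      (pochSeries m k * P - 1) * (pochSeries m (2 * N - k) * P) +
        (pochSeries m (2 * N - k) * P - 1) by ring]
    exact dvd_add (((pow_dvd_pow _ (min_le_left _ _)).trans h1).mul_right _)
      ((pow_dvd_pow _ (min_le_right _ _)).trans h2)
  have h4 := mul_dvd_mul (X_pow_dvd_signedOddMultSeries ((a : ℤ) + 4 * m * (k - N))) h3
  rw [← pow_add] at h4
  refine dvd_trans (pow_dvd_pow _ ?_) h4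
  rcases le_or_gt N k with h | h
  · obtain ⟨d, rfl⟩ := Nat.exists_eq_add_of_le h
    have e : (a : ℤ) + 4 * m * ((N + d : ℕ) - N) = (a + 4 * m * d : ℕ) := by push_cast; ring
    have : d ≤ 4 * m * d := Nat.le_mul_of_pos_left _ (by positivity)
    rw [e, Int.natAbs_natCast]
    omega
  · obtain ⟨d, rfl⟩ := Nat.exists_eq_add_of_lt h
    have e : (a : ℤ) + 4 * m * (k - (k + d + 1 : ℕ)) = -((4 * m * (d + 1) : ℕ) - a : ℤ) := by
      push_cast; ring
    have h4 : d + 1 ≤ 2 * m * (d + 1) := Nat.le_mul_of_pos_left _ (by positivity)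
    have h5 : 2 * m ≤ 2 * m * (d + 1) := Nat.le_mul_of_pos_right _ (by positivity)
    have h6 : 4 * m * (d + 1) = 2 * m * (d + 1) + 2 * m * (d + 1) := by ring
    rw [e, Int.natAbs_neg]
    omega

/-- The sign attached to `k` by its residue class modulo `4 * m`. -/
def residueSign (m a k : ℕ) : ℚ :=
  if (k : ZMod (4 * m)) = a then 1 else if (k : ZMod (4 * m)) = -a then -1 else 0

theorem sum_residueSign_mul {m a : ℕ} (ha : 0 < a) (ham : a < 2 * m) (h : ℕ → ℚ⟦X⟧) (N : ℕ) :
    ∑ k ∈ range (4 * m * N), C (residueSign m a k) * h k =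
      ∑ n ∈ range N, (h (4 * m * n + a) - h (4 * m * n + (4 * m - a))) := by
  induction N with
  | zero => simp
  | succ N ih =>
    rw [mul_add_one, sum_range_add, ih, sum_range_succ]
    congr 1
    have key : ∀ r ∈ range (4 * m), C (residueSign m a (4 * m * N + r)) * h (4 * m * N + r) =
        (if r = a then h (4 * m * N + a) else 0) +
          (if r = 4 * m - a then - h (4 * m * N + (4 * m - a)) else 0) := by
      intro r hr
      have hr' := mem_range.mp hr
      have e1 : ((4 * m * N + r : ℕ) : ZMod (4 * m)) = a ↔ r = a := by
        rw [ZMod.natCast_eq_natCast_iff', Nat.mul_add_mod, Nat.mod_eq_of_lt hr',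
          Nat.mod_eq_of_lt (by omega)]
      have e2 : ((4 * m * N + r : ℕ) : ZMod (4 * m)) = -a ↔ r = 4 * m - a := by
        have : (-a : ZMod (4 * m)) = ((4 * m - a : ℕ) : ZMod (4 * m)) := by
          rw [Nat.cast_sub (by omega), ZMod.natCast_self, zero_sub]
        rw [this, ZMod.natCast_eq_natCast_iff', Nat.mul_add_mod, Nat.mod_eq_of_lt hr',
          Nat.mod_eq_of_lt (by omega)]
      simp only [residueSign, e1, e2]
      split_ifs with h1 h2 h2
      · omega
      · simp [h1]
      · simp [h2]
      · simp
    rw [sum_congr rfl key, sum_add_distrib, sum_ite_eq', sum_ite_eq',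
      if_pos (mem_range.mpr (by omega)), if_pos (mem_range.mpr (by omega))]
    ring

theorem sum_signedOddMultSeries {m a : ℕ} (ha : 0 < a) (ham : a < 2 * m) (N : ℕ) :
    ∑ k ∈ range (2 * N + 1), signedOddMultSeries ((a : ℤ) + 4 * m * (k - N)) =
      ∑ n ∈ range N, (oddMultSeries (4 * m * n + a) - oddMultSeries (4 * m * n + (4 * m - a))) +
        oddMultSeries (4 * m * N + a) := by
  rw [show 2 * N + 1 = N + (N + 1) by ring, sum_range_add, ← sum_range_reflect, sum_range_succ,
    ← add_assoc, ← sum_add_distrib]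
  have hpos : ∀ n : ℕ, signedOddMultSeries ((a : ℤ) + 4 * m * ((N + n : ℕ) - N)) =
      oddMultSeries (4 * m * n + a) := by
    intro n
    rw [show (a : ℤ) + 4 * m * ((N + n : ℕ) - N) = (4 * m * n + a : ℕ) by push_cast; ring,
      signedOddMultSeries, Int.sign_eq_one_of_pos (by positivity), Int.natAbs_natCast,
      Int.cast_one, one_mul]
  rw [hpos]
  congr 1
  refine sum_congr rfl fun n hn => ?_
  have hn' := mem_range.mp hn
  rw [hpos, show (a : ℤ) + 4 * m * ((N - 1 - n : ℕ) - N) = -(4 * m * n + (4 * m - a) : ℕ) by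
    rw [show ((N - 1 - n : ℕ) : ℤ) = N - 1 - n by omega]
    push_cast [show a ≤ 4 * m by omega]
    ring, signedOddMultSeries, Int.sign_neg,
    Int.sign_eq_one_of_pos (Int.natCast_pos.mpr (by omega))]
  simp only [Int.natAbs_neg, Int.natAbs_natCast, Int.cast_neg, Int.cast_one]
  ring

/-- `∑ ± X ^ (k * l)` over `k ≡ ± a` modulo `4 * m` and odd `l`, truncated. -/
noncomputable def residueSeries (m N a : ℕ) : ℚ⟦X⟧ :=
  ∑ p ∈ range (4 * m * N) ×ˢ range N,
    C (residueSign m a p.1) * X ^ (p.1 * (2 * p.2 + 1))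

theorem X_pow_dvd_sum_signedOddMultSeries_sub {m a : ℕ} (ha : 0 < a) (ham : a < 2 * m) (N : ℕ) :
    X ^ N ∣ ∑ k ∈ range (2 * N + 1), signedOddMultSeries ((a : ℤ) + 4 * m * (k - N)) -
      residueSeries m N a := by
  have h : residueSeries m N a = ∑ n ∈ range N,
      ((∑ j ∈ range N, X ^ ((4 * m * n + a) * (2 * j + 1))) -
        ∑ j ∈ range N, X ^ ((4 * m * n + (4 * m - a)) * (2 * j + 1))) := by
    rw [← sum_residueSign_mul ha ham (fun k => ∑ j ∈ range N, X ^ (k * (2 * j + 1))),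
      residueSeries, sum_product]
    simp only [mul_sum]
  rw [h, sum_signedOddMultSeries ha ham, add_sub_right_comm, ← sum_sub_distrib]
  refine dvd_add (dvd_sum fun n _ => ?_) ?_
  · rw [sub_sub_sub_comm]
    exact dvd_sub (oddMultSeries_sub_sum (by omega) N) (oddMultSeries_sub_sum (by omega) N)
  · refine Dvd.dvd.mul_right (pow_dvd_pow _ ?_) _
    nlinarith

/-- The generating function identity behind the theorem, modulo `X ^ N`. -/
theorem X_pow_dvd_prod_residueSeries_sub {m : ℕ} (hm : 0 < m) (N : ℕ) :
    X ^ N ∣ ∏ i ∈ range m, residueSeries m N (2 * i + 1) -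
      X ^ (m ^ 2) * triangleSeries m (4 * N) ^ (2 * m) := by
  set φ := Ideal.Quotient.mk (Ideal.span {(X : ℚ⟦X⟧) ^ N})
  have hφ : ∀ f g : ℚ⟦X⟧, φ f = φ g ↔ X ^ N ∣ f - g := fun f g => by
    rw [Ideal.Quotient.eq, Ideal.mem_span_singleton]
  have hfac : ∀ i ∈ range m, φ (residueSeries m N (2 * i + 1)) =
      φ (∑ k ∈ range (2 * N + 1), pochSeries m (2 * N - k) * pochSeries m k *
        signedOddMultSeries ((2 * i + 1 : ℤ) + 4 * m * (k - N))) *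
        φ (triangleSeries m (4 * N)) ^ 2 := by
    intro i hi
    have hi' := mem_range.mp hi
    rw [← (hφ _ _).mpr (X_pow_dvd_sum_signedOddMultSeries_sub (m := m) (a := 2 * i + 1)
      (by omega) (by omega) N), ← map_pow, ← map_mul, eq_comm, hφ, sum_mul, ← sum_sub_distrib]
    refine dvd_sum fun k hk => ?_
    have hk' := mem_range.mp hk
    convert X_pow_dvd_signedOddMultSeries_mul (a := 2 * i + 1) hm (by omega)
      (Nat.lt_succ_iff.mp hk') using 1
    push_cast
    ring
  have hone : φ (∏ i ∈ range m, (1 - X ^ (2 * (2 * i + 1) + 8 * m * N))) = 1 := by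
    rw [map_prod]
    refine prod_eq_one fun i _ => ?_
    rw [← map_one φ, hφ, sub_sub_cancel_left, dvd_neg]
    exact pow_dvd_pow _ (by nlinarith)
  have hmain := congrArg φ (prod_sum_pochSeries hm N)
  rw [map_mul, hone, mul_one, map_prod] at hmain
  rw [← hφ, map_prod, prod_congr rfl hfac, prod_mul_distrib, hmain, prod_const, card_range,
    map_mul, map_pow φ (triangleSeries m (4 * N)), pow_mul]

theorem coeff_prod_sum_C_mul_X_pow {ι β : Type*} [Fintype ι] [DecidableEq ι] (s : Finset β)
    (c : ι → β → ℚ) (e : β → ℕ) (n : ℕ) :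
    coeff n (∏ i, ∑ b ∈ s, C (c i b) * X ^ e b) =
      ∑ f ∈ Fintype.piFinset fun _ : ι => s, if ∑ i, e (f i) = n then ∏ i, c i (f i) else 0 := by
  rw [prod_univ_sum, map_sum]
  refine sum_congr rfl fun f _ => ?_
  rw [prod_mul_distrib, ← map_prod, prod_pow_eq_pow_sum, coeff_C_mul, coeff_X_pow]
  simp [eq_comm]

theorem coeff_triangleSeries_pow {m : ℕ} (hm : 0 < m) {x L : ℕ} (hx : x < L) (d : ℕ) :
    coeff x (triangleSeries m L ^ d) =
      ((if 4 * m ∣ x then triangleReps d (x / (4 * m)) else 0 : ℕ) : ℚ) := by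
  have h : triangleSeries m L ^ d = ∏ _i : Fin d, ∑ s ∈ range L,
      C (1 : ℚ) * X ^ (4 * m * (s * (s + 1) / 2)) := by
    simp [triangleSeries]
  rw [h, coeff_prod_sum_C_mul_X_pow _ (fun _ _ => 1) (fun s => 4 * m * (s * (s + 1) / 2))]
  simp only [prod_const_one, ← mul_sum]
  rw [sum_boole]
  congr 1
  split_ifs with hd
  · obtain ⟨y, rfl⟩ := hd
    rw [Nat.mul_div_cancel_left _ (by positivity), triangleReps, eq_comm]
    refine Nat.subtype_card _ fun f => ?_
    rw [mem_filter, Nat.mul_right_inj (by positivity), and_iff_right_iff_imp, Fintype.mem_piFinset]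
    rintro rfl i
    have h1 : f i * (f i + 1) / 2 ≤ ∑ i, f i * (f i + 1) / 2 :=
      single_le_sum (f := fun i => f i * (f i + 1) / 2) (fun _ _ => Nat.zero_le _) (mem_univ i)
    have h2 : f i ≤ f i * (f i + 1) / 2 := by
      rw [Nat.le_div_iff_mul_le two_pos]
      rcases Nat.eq_zero_or_pos (f i) with h0 | h0
      · simp [h0]
      · nlinarith
    have h3 := Nat.le_mul_of_pos_left (∑ i, f i * (f i + 1) / 2) (show 0 < 4 * m by positivity)
    exact mem_range.mpr (by omega)
  · rw [card_eq_zero, filter_eq_empty_iff]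
    rintro f - rfl
    exact hd (dvd_mul_right _ _)


theorem finsum_subtype_eq_sum {α M : Type*} [AddCommMonoid M] {P : α → Prop} (s : Finset α)
    (hs : ∀ a, P a ↔ a ∈ s) (f : α → M) : ∑ᶠ p : {a // P a}, f p = ∑ a ∈ s, f a := by
  obtain rfl : P = (· ∈ s) := funext fun a => propext (hs a)
  exact (finsum_set_coe_eq_finsum_mem (s : Set α)).trans (finsum_mem_coe_finset f s)

theorem residueSign_ne_zero_iff {m a k : ℕ} :
    residueSign m a k ≠ 0 ↔ (k : ZMod (4 * m)) = a ∨ (k : ZMod (4 * m)) = -a := by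
  rw [residueSign]
  split_ifs with h1 h2
  · simp [h1]
  · simp [h2]
  · simp [h1, h2]

theorem natCast_ne_neg_natCast {m a : ℕ} (ha : 0 < a) (ham : a < 2 * m) :
    (a : ZMod (4 * m)) ≠ -a := by
  intro h
  rw [eq_neg_iff_add_eq_zero, ← Nat.cast_add, ZMod.natCast_eq_zero_iff] at h
  exact absurd (Nat.le_of_dvd (by omega) h) (by omega)

theorem odd_of_natCast_eq_or {m a k : ℕ} (ha : Odd a)
    (h : (k : ZMod (4 * m)) = a ∨ (k : ZMod (4 * m)) = -a) : Odd k := by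
  have h2 : 2 ∣ 4 * m := ⟨2 * m, by ring⟩
  have hk : (k : ZMod 2) = a := by
    rcases h with h | h <;> have h' := congrArg (ZMod.castHom h2 (ZMod 2)) h
    · simpa using h'
    · rw [map_neg, map_natCast, map_natCast] at h'
      rwa [ZMod.neg_eq_self_mod_two] at h'
  rw [ZMod.natCast_eq_natCast_iff'] at hk
  rw [Nat.odd_iff] at ha ⊢
  omega

theorem prod_residueSign {m : ℕ} (k : Fin m → ℕ) 
    (h : ∀ i : Fin m, residueSign m (2 * i + 1) (k i) ≠ 0) :
    ∏ i : Fin m, residueSign m (2 * i + 1) (k i) = (-1) ^ (univ.filter (fun i : Fin m =>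
      (k i : ZMod (4 * m)) = -((2 * (i : ℕ) + 1 : ℕ) : ZMod (4 * m)))).card := by
  rw [← prod_const, prod_filter]
  refine prod_congr rfl fun i _ => ?_
  have hi := residueSign_ne_zero_iff.mp (h i)
  have hne := natCast_ne_neg_natCast (m := m) (a := 2 * i + 1) (by omega) (by omega)
  rw [residueSign]
  split_ifs with h1 h2 h2
  · exact absurd (h1.symm.trans h2) hne
  · rfl
  · rfl
  · tauto

end PowerSeries

theorem getz_mahlburg_two_m (m x : ℕ) (hm : 0 < m) :
    ((if 4 * m ∣ x then triangleReps (2 * m) (x / (4 * m)) else 0 : ℕ) : ℤ) =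
      ∑ᶠ p : {kl : (Fin m → ℕ) × (Fin m → ℕ) //
          (∀ i, Odd (kl.1 i)) ∧ (∀ i, Odd (kl.2 i)) ∧
          (∑ i, kl.1 i * kl.2 i) = m ^ 2 + x ∧
          ∀ i : Fin m, ((kl.1 i : ZMod (4 * m)) = ((2 * (i : ℕ) + 1 : ℕ) : ZMod (4 * m)) ∨
            (kl.1 i : ZMod (4 * m)) = -((2 * (i : ℕ) + 1 : ℕ) : ZMod (4 * m)))},
        (-1 : ℤ) ^ (Finset.univ.filter (fun i : Fin m =>
          ((p : (Fin m → ℕ) × (Fin m → ℕ)).1 i : ZMod (4 * m)) =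
            -((2 * (i : ℕ) + 1 : ℕ) : ZMod (4 * m)))).card := by
  set N := m ^ 2 + x + 1 with hN
  have hcoeff := PowerSeries.X_pow_dvd_iff.mp (X_pow_dvd_prod_residueSeries_sub hm N)
    (m ^ 2 + x) (Nat.lt_succ_self _)
  rw [map_sub, sub_eq_zero, add_comm (m ^ 2) x, PowerSeries.coeff_X_pow_mul,
    coeff_triangleSeries_pow hm (by omega), add_comm x,
    ← Fin.prod_univ_eq_prod_range (fun i => residueSeries m N (2 * i + 1))] at hcoeff
  simp only [residueSeries] at hcoeff
  rw [coeff_prod_sum_C_mul_X_pow _ (fun (i : Fin m) (p : ℕ × ℕ) => residueSign m (2 * i + 1) p.1)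
    (fun p => p.1 * (2 * p.2 + 1))] at hcoeff
  set box := Fintype.piFinset fun _ : Fin m => range (4 * m * N) ×ˢ range N
  let T := {f ∈ box | ∑ i, (f i).1 * (2 * (f i).2 + 1) = m ^ 2 + x ∧
    ∀ i : Fin m, residueSign m (2 * i + 1) (f i).1 ≠ 0}
  let pair : (Fin m → ℕ × ℕ) → (Fin m → ℕ) × (Fin m → ℕ) :=
    fun f => (fun i => (f i).1, fun i => 2 * (f i).2 + 1)
  have hinj : Function.Injective pair := by
    intro f g h
    funext i
    have h1 := congrFun (congrArg Prod.fst h) i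
    have h2 := congrFun (congrArg Prod.snd h) i
    simp only [pair] at h1 h2
    exact Prod.ext h1 (by omega)
  rw [finsum_subtype_eq_sum (T.image pair) ?mem_iff (fun kl => (-1 : ℤ) ^ (univ.filter
    (fun i : Fin m => (kl.1 i : ZMod (4 * m)) =
      -((2 * (i : ℕ) + 1 : ℕ) : ZMod (4 * m)))).card), sum_image hinj.injOn]
  case mem_iff =>
    rintro ⟨k, l⟩
    simp only [mem_image, T, mem_filter, residueSign_ne_zero_iff, pair, Prod.mk.injEq]
    constructor
    · rintro ⟨hk, hl, hsum, hres⟩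
      have hl' : ∀ i, 2 * (l i / 2) + 1 = l i := fun i => Nat.two_mul_div_two_add_one_of_odd (hl i)
      refine ⟨fun i => (k i, l i / 2), ⟨?_, by simpa only [hl'] using hsum, hres⟩, rfl, funext hl'⟩
      refine Fintype.mem_piFinset.mpr fun i => ?_
      have h1 : k i * l i ≤ ∑ i, k i * l i :=
        single_le_sum (f := fun i => k i * l i) (fun _ _ => Nat.zero_le _) (mem_univ i)
      have h2 := Nat.le_mul_of_pos_right (k i) (hl i).pos
      have h3 := Nat.le_mul_of_pos_left (l i) (hk i).pos
      have h4 := Nat.le_mul_of_pos_left N (show 0 < 4 * m by positivity)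
      simp only [mem_product, mem_range]
      omega
    · rintro ⟨f, ⟨-, hsum, hres⟩, rfl, rfl⟩
      exact ⟨fun i => odd_of_natCast_eq_or ⟨i, rfl⟩ (hres i), fun i => ⟨_, rfl⟩, hsum, hres⟩
  have hcast : ∀ a : ℕ, ∀ b : ℤ, (a : ℚ) = b → (a : ℤ) = b := fun a b h => by exact_mod_cast h
  refine hcast _ _ ?_
  rw [← hcoeff, Int.cast_sum, sum_filter]
  refine sum_congr rfl fun f _ => ?_
  by_cases hsum : ∑ i, (f i).1 * (2 * (f i).2 + 1) = m ^ 2 + x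
  · by_cases hres : ∀ i : Fin m, residueSign m (2 * i + 1) (f i).1 ≠ 0
    · rw [if_pos hsum, if_pos ⟨hsum, hres⟩, prod_residueSign _ hres]
      push_cast
      rfl
    · rw [if_pos hsum, if_neg fun h => hres h.2]
      push Not at hres
      obtain ⟨i, hi⟩ := hres
      exact prod_eq_zero (mem_univ i) hi
  · rw [if_neg hsum, if_neg fun h => hsum h.1]
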